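/- arXiv:math/0511607 — 2 statements merged into one kernel-verified Lean document; each statement's English description precedes it below -/
import Mathlib

section
/- There exists a constant C' > 0 such that, for every integer n ≥ 2, every nontrivial monotone symmetric subset A of {0,1}^n, and every ε ∈ (0,1/2), the threshold width satisfies τ(A,ε) ≤ C' · log((1−ε)/ε) / log n. -/
open Finset

/-- Weight of a point `x ∈ {0,1}^n` under the product Bernoulli(p) measure:
`p^{∑ xᵢ} (1-p)^{∑ (1-xᵢ)}`. -/
noncomputable def muW (n : ℕ) (p : ℝ) (x : Fin n → Bool) : ℝ :=
  ∏ i : Fin n, if x i then p else 1 - p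

/-- The measure `μ_{n,p}(A)` of a subset `A ⊆ {0,1}^n`. -/
noncomputable def muP (n : ℕ) (p : ℝ) (A : Finset (Fin n → Bool)) : ℝ :=
  ∑ x ∈ A, muW n p x

/-- Expectation `∫ f dμ_{n,p}` of a real function on `{0,1}^n`. -/
noncomputable def muE (n : ℕ) (p : ℝ) (f : (Fin n → Bool) → ℝ) : ℝ :=
  ∑ x : Fin n → Bool, muW n p x * f x

/-- `A` is monotone: `x ∈ A` and `x ≤ y` coordinatewise imply `y ∈ A`. -/
def MonotoneSet (n : ℕ) (A : Finset (Fin n → Bool)) : Prop :=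
  ∀ x ∈ A, ∀ y : Fin n → Bool, (∀ i, x i ≤ y i) → y ∈ A

/-- `A` is symmetric: invariant under a transitive subgroup of permutations of coordinates. -/
def SymmetricSet (n : ℕ) (A : Finset (Fin n → Bool)) : Prop :=
  ∃ G : Subgroup (Equiv.Perm (Fin n)),
    (∀ i j : Fin n, ∃ g ∈ G, g i = j) ∧
    (∀ g ∈ G, ∀ x ∈ A, (fun i => x (g⁻¹ i)) ∈ A)

/-- Discrete gradient `∇_i f`. -/
noncomputable def grad (n : ℕ) (i : Fin n) (f : (Fin n → Bool) → ℝ)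
    (x : Fin n → Bool) : ℝ :=
  f (Function.update x i true) - f (Function.update x i false)

/-- The operator `Δ_i f = f - ∫ f dμ_{1,p}(x_i)`. -/
noncomputable def del (n : ℕ) (p : ℝ) (i : Fin n) (f : (Fin n → Bool) → ℝ)
    (x : Fin n → Bool) : ℝ :=
  f x - (p * f (Function.update x i true) + (1 - p) * f (Function.update x i false))

open Classical in
/-- Influence of coordinate `i` on a function `f`: the `μ_{n,p}`-probability
that `f` is not constant on the `i`-th fiber. -/
noncomputable def infl (n : ℕ) (p : ℝ) (i : Fin n) (f : (Fin n → Bool) → ℝ) : ℝ :=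
  muP n p (Finset.univ.filter fun x =>
    f (Function.update x i true) ≠ f (Function.update x i false))

open Classical in
/-- Influence of coordinate `i` on a set `A`. -/
noncomputable def inflSet (n : ℕ) (p : ℝ) (i : Fin n) (A : Finset (Fin n → Bool)) : ℝ :=
  muP n p (Finset.univ.filter fun x =>
    ¬((Function.update x i true ∈ A) ↔ (Function.update x i false ∈ A)))

/-- Entropy of a (nonnegative) function with respect to `μ_{n,p}`. -/
noncomputable def ent (n : ℕ) (p : ℝ) (g : (Fin n → Bool) → ℝ) : ℝ :=
  muE n p (fun x => g x * Real.log (g x)) - muE n p g * Real.log (muE n p g)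

/-- Variance of a function with respect to `μ_{n,p}`. -/
noncomputable def varE (n : ℕ) (p : ℝ) (f : (Fin n → Bool) → ℝ) : ℝ :=
  muE n p (fun x => f x ^ 2) - (muE n p f) ^ 2

/-- Conditional expectation `E[f | x_1, …, x_j]` under `μ_{n,p}`:
average over the last `n - j` coordinates. -/
noncomputable def condE (n : ℕ) (p : ℝ) (j : ℕ) (f : (Fin n → Bool) → ℝ)
    (x : Fin n → Bool) : ℝ :=
  ∑ y : Fin n → Bool,
    (∏ i : Fin n, if (i : ℕ) < j then (if y i = x i then (1 : ℝ) else 0)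
      else (if y i then p else 1 - p)) * f y

/-- The logarithmic Sobolev constant of the two-point Bernoulli(p) space. -/
noncomputable def cLS (p : ℝ) : ℝ :=
  if p = 1 / 2 then 2 else (Real.log (1 - p) - Real.log p) / (1 - 2 * p)

/-- The sequence `s(n)` of Theorem 4.1. -/
noncomputable def sseq (n : ℕ) : ℝ :=
  Real.log n -
    max (Real.log ((Real.exp 1 ^ (2 + 4 / Real.exp 1) / (2 : ℝ) ^ (5 + 4 / Real.exp 1)) *
        Real.log ((n : ℝ) / Real.log n ^ 2) ^ (3 + 4 / Real.exp 1)))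
      (2 * Real.log (Real.log n))

lemma muE_zero (p : ℝ) (f : (Fin 0 → Bool) → ℝ) : muE 0 p f = f default := by
  simp only [muE, muW, Finset.univ_eq_empty, Finset.prod_empty, one_mul, Fintype.sum_unique]
  exact congrArg f (Subsingleton.elim _ _)

lemma muW_cons (n : ℕ) (p : ℝ) (b : Bool) (y : Fin n → Bool) :
    muW (n+1) p (Fin.cons b y) = (if b then p else 1 - p) * muW n p y := by
  unfold muW
  rw [Fin.prod_univ_succ]
  simp

lemma muE_succ (n : ℕ) (p : ℝ) (f : (Fin (n+1) → Bool) → ℝ) :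
    muE (n+1) p f = (1-p) * muE n p (fun y => f (Fin.cons false y))
      + p * muE n p (fun y => f (Fin.cons true y)) := by
  unfold muE
  rw [← (Fin.consEquiv (fun _ : Fin (n+1) => Bool)).sum_comp]
  rw [Fintype.sum_prod_type]
  simp only [Fintype.sum_bool, Fin.consEquiv, Equiv.coe_fn_mk, muW_cons]
  rw [Finset.mul_sum, Finset.mul_sum, add_comm]
  simp [mul_assoc]

lemma grad_zero_cons (n : ℕ) (f : (Fin (n+1) → Bool) → ℝ) (b : Bool) (y : Fin n → Bool) :
    grad (n+1) 0 f (Fin.cons b y) = f (Fin.cons true y) - f (Fin.cons false y) := by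
  simp [grad, Fin.update_cons_zero]

lemma grad_succ_cons (n : ℕ) (i : Fin n) (f : (Fin (n+1) → Bool) → ℝ) (b : Bool)
    (y : Fin n → Bool) :
    grad (n+1) i.succ f (Fin.cons b y) = grad n i (fun z => f (Fin.cons b z)) y := by
  simp [grad, Fin.cons_update]

lemma muE_add (n : ℕ) (p : ℝ) (f g : (Fin n → Bool) → ℝ) :
    muE n p (fun x => f x + g x) = muE n p f + muE n p g := by
  simp [muE, mul_add, Finset.sum_add_distrib]

lemma muE_smul (n : ℕ) (p c : ℝ) (f : (Fin n → Bool) → ℝ) :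
    muE n p (fun x => c * f x) = c * muE n p f := by
  simp only [muE, Finset.mul_sum]
  exact Finset.sum_congr rfl fun x _ => by ring

lemma muW_pos (n : ℕ) (p : ℝ) (hp : p ∈ Set.Ioo (0:ℝ) 1) (x : Fin n → Bool) : 0 < muW n p x := by
  unfold muW
  refine Finset.prod_pos fun i _ => ?_
  split_ifs
  · exact hp.1
  · linarith [hp.2]

lemma muE_mono (n : ℕ) (p : ℝ) (hp : p ∈ Set.Ioo (0:ℝ) 1) (f g : (Fin n → Bool) → ℝ)
    (h : ∀ x, f x ≤ g x) : muE n p f ≤ muE n p g := by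
  unfold muE
  exact Finset.sum_le_sum fun x _ => mul_le_mul_of_nonneg_left (h x) (muW_pos n p hp x).le

lemma muE_nonneg (n : ℕ) (p : ℝ) (hp : p ∈ Set.Ioo (0:ℝ) 1) (f : (Fin n → Bool) → ℝ)
    (h : ∀ x, 0 ≤ f x) : 0 ≤ muE n p f := by
  unfold muE
  exact Finset.sum_nonneg fun x _ => mul_nonneg (muW_pos n p hp x).le (h x)

lemma muE_cs (n : ℕ) (p : ℝ) (hp : p ∈ Set.Ioo (0:ℝ) 1) (f g : (Fin n → Bool) → ℝ) :
    muE n p (fun x => f x * g x) ≤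
      √(muE n p (fun x => f x ^ 2)) * √(muE n p (fun x => g x ^ 2)) := by
  rw [← Real.sqrt_mul (muE_nonneg n p hp _ fun x => sq_nonneg _)]
  apply Real.le_sqrt_of_sq_le
  unfold muE
  apply Finset.sum_sq_le_sum_mul_sum_of_sq_le_mul
  · intro x _; exact mul_nonneg (muW_pos n p hp x).le (sq_nonneg _)
  · intro x _; exact mul_nonneg (muW_pos n p hp x).le (sq_nonneg _)
  · intro x _; exact le_of_eq (by ring)

/-- Dirichlet form. -/
noncomputable def SqF (n : ℕ) (p : ℝ) (f : (Fin n → Bool) → ℝ) : ℝ :=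
  ∑ i, muE n p (fun x => grad n i f x ^ 2)

lemma SqF_succ (n : ℕ) (p : ℝ) (f : (Fin (n+1) → Bool) → ℝ) :
    SqF (n+1) p f = muE n p (fun y => (f (Fin.cons true y) - f (Fin.cons false y)) ^ 2)
      + (1-p) * SqF n p (fun y => f (Fin.cons false y))
      + p * SqF n p (fun y => f (Fin.cons true y)) := by
  unfold SqF
  rw [Fin.sum_univ_succ]
  simp only [muE_succ, grad_zero_cons, grad_succ_cons, Finset.sum_add_distrib, Finset.mul_sum]
  ring

lemma xlog_aux (A M : ℝ) (hA : 0 ≤ A) (hM : 0 < M) :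
    A * Real.log A - A * Real.log M ≤ A * (A / M - 1) := by
  rcases hA.eq_or_lt with rfl | hA
  · simp
  · rw [← mul_sub, ← Real.log_div hA.ne' hM.ne']
    exact mul_le_mul_of_nonneg_left (Real.log_le_sub_one_of_pos (div_pos hA hM)) hA.le

lemma two_point (p : ℝ) (hp : p ∈ Set.Ioo (0:ℝ) 1) (A B : ℝ) (hA : 0 ≤ A) (hB : 0 ≤ B) :
    (1-p) * (A * Real.log A) + p * (B * Real.log B)
      - ((1-p) * A + p * B) * Real.log ((1-p) * A + p * B) ≤ (√A - √B) ^ 2 := by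
  obtain ⟨h0, h1⟩ := hp
  have hq : 0 < 1 - p := by linarith
  set M := (1-p) * A + p * B with hM
  have hM0 : 0 ≤ M := by positivity
  rcases hM0.eq_or_lt with h | hMp
  · have ha : (1-p) * A = 0 := by nlinarith [mul_nonneg hq.le hA, mul_nonneg h0.le hB]
    have hb : p * B = 0 := by nlinarith [mul_nonneg hq.le hA, mul_nonneg h0.le hB]
    have ha' : A = 0 := by simpa [hq.ne'] using ha
    have hb' : B = 0 := by simpa [h0.ne'] using hb
    rw [← h, ha', hb']; simp
  · have e1 := mul_le_mul_of_nonneg_left (xlog_aux A M hA hMp) hq.le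
    have e2 := mul_le_mul_of_nonneg_left (xlog_aux B M hB hMp) h0.le
    have e3 : (1-p) * (A * (A / M - 1)) + p * (B * (B / M - 1))
        = p * (1-p) * (A - B)^2 / M := by
      field_simp
      rw [hM]; ring
    have e4 : p * (1-p) * (A - B)^2 / M ≤ (√A - √B) ^ 2 := by
      rw [div_le_iff₀ hMp]
      have sa := Real.sq_sqrt hA
      have sb := Real.sq_sqrt hB
      set a := √A
      set b := √B
      rw [hM, ← sa, ← sb]
      have : 0 ≤ (a-b)^2 * ((1-p) * a - p * b)^2 := by positivity
      nlinarith [this]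
    have e5 : M * Real.log M = (1-p) * (A * Real.log M) + p * (B * Real.log M) := by
      rw [hM]; ring
    rw [e5]
    linarith

lemma lsi (p : ℝ) (hp : p ∈ Set.Ioo (0:ℝ) 1) (n : ℕ) : ∀ g : (Fin n → Bool) → ℝ,
    ent n p (fun x => g x ^ 2) ≤ SqF n p g := by
  induction n with
  | zero => intro g; simp [ent, SqF, muE_zero]
  | succ n ih =>
    intro g
    have i0 := ih (fun y => g (Fin.cons false y))
    have i1 := ih (fun y => g (Fin.cons true y))
    rw [SqF_succ]
    simp only [ent, muE_succ] at i0 i1 ⊢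
    set g0 : (Fin n → Bool) → ℝ := fun y => g (Fin.cons false y) with hg0
    set g1 : (Fin n → Bool) → ℝ := fun y => g (Fin.cons true y) with hg1
    set A := muE n p (fun y => g (Fin.cons false y) ^ 2) with hA
    set B := muE n p (fun y => g (Fin.cons true y) ^ 2) with hB
    have hA0 : 0 ≤ A := muE_nonneg n p hp _ fun x => sq_nonneg _
    have hB0 : 0 ≤ B := muE_nonneg n p hp _ fun x => sq_nonneg _
    have tp := two_point p hp A B hA0 hB0
    have cs := muE_cs n p hp g0 g1
    have e : muE n p (fun y => (g (Fin.cons true y) - g (Fin.cons false y)) ^ 2)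
        = A + B - 2 * muE n p (fun x => g0 x * g1 x) := by
      have : (fun y => (g (Fin.cons true y) - g (Fin.cons false y)) ^ 2)
        = fun y => (g (Fin.cons false y) ^ 2 + g (Fin.cons true y) ^ 2)
            + (-2) * (g0 y * g1 y) := by
        funext y; simp only [hg0, hg1]; ring
      rw [this, muE_add, muE_add, muE_smul]; ring
    have e2 : (√A - √B) ^ 2 = A + B - 2 * (√A * √B) := by
      nlinarith [Real.sq_sqrt hA0, Real.sq_sqrt hB0]
    change muE n p (fun x => g0 x * g1 x) ≤ √A * √B at cs
    have hp1 : 0 ≤ 1 - p := by linarith [hp.2]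
    have j0 := mul_le_mul_of_nonneg_left i0 hp1
    have j1 := mul_le_mul_of_nonneg_left i1 hp.1.le
    rw [e]
    linarith

lemma ent_lower (n : ℕ) (p : ℝ) (hp : p ∈ Set.Ioo (0:ℝ) 1) (g : (Fin n → Bool) → ℝ)
    (T : ℝ) (hT : 0 < T) :
    muE n p (fun x => g x ^ 2) * Real.log T - T * (muE n p (fun x => |g x|)) ^ 2
      ≤ ent n p (fun x => g x ^ 2) := by
  unfold ent
  set m := muE n p (fun x => g x ^ 2) with hm
  set k := muE n p (fun x => |g x|) with hk
  have hm0 : 0 ≤ m := muE_nonneg n p hp _ fun x => sq_nonneg _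
  have hk0 : 0 ≤ k := muE_nonneg n p hp _ fun x => abs_nonneg _
  by_cases hz : ∀ x, g x = 0
  · have : m = 0 := by simp [hm, muE, hz]
    have h2 : k = 0 := by simp [hk, muE, hz]
    rw [this, h2]; simp [muE, hz]
  push Not at hz
  obtain ⟨x0, hx0⟩ := hz
  have hmp : 0 < m := by
    rw [hm]; unfold muE
    refine Finset.sum_pos' (fun x _ => mul_nonneg (muW_pos n p hp x).le (sq_nonneg _))
      ⟨x0, Finset.mem_univ _, mul_pos (muW_pos n p hp x0) (by positivity)⟩
  have hkp : 0 < k := by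
    rw [hk]; unfold muE
    refine Finset.sum_pos' (fun x _ => mul_nonneg (muW_pos n p hp x).le (abs_nonneg _))
      ⟨x0, Finset.mem_univ _, mul_pos (muW_pos n p hp x0) (by positivity)⟩
  have hs : 0 < m / k := div_pos hmp hkp
  have pt : ∀ x, (2 * Real.log (m/k) + 2) * g x ^ 2 + (-(2 * (m / k))) * |g x|
      ≤ g x ^ 2 * Real.log (g x ^ 2) := by
    intro x
    by_cases hx : g x = 0
    · simp [hx]
    have hx' : 0 < |g x| := abs_pos.mpr hx
    have := Real.log_le_sub_one_of_pos (div_pos hs hx')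
    rw [Real.log_div hs.ne' hx'.ne'] at this
    rw [← sq_abs (g x), Real.log_pow]
    have h3 := mul_le_mul_of_nonneg_left this (sq_nonneg |g x|)
    have h4 : |g x| ^ 2 * (m / k / |g x| - 1) = (m/k) * |g x| - |g x| ^ 2 := by
      field_simp
    rw [h4] at h3
    push_cast
    linarith
  have := muE_mono n p hp _ _ pt
  rw [muE_add, muE_smul, muE_smul, ← hm, ← hk] at this
  have e1 : m / k * k = m := by field_simp
  have e2 : Real.log (m/k) = Real.log m - Real.log k := Real.log_div hmp.ne' hkp.ne'
  have e3 : Real.log (T * k ^ 2 / m) ≤ T * k ^ 2 / m - 1 :=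
    Real.log_le_sub_one_of_pos (by positivity)
  rw [Real.log_div (by positivity) (by positivity), Real.log_mul (by positivity) (by positivity),
    Real.log_pow] at e3
  have e4 := mul_le_mul_of_nonneg_left e3 hm0
  have e5 : m * (T * k ^ 2 / m - 1) = T * k ^ 2 - m := by field_simp
  rw [e5] at e4
  push_cast at e4
  rw [e2] at this
  nlinarith

lemma SqF_lower (n : ℕ) (p : ℝ) (hp : p ∈ Set.Ioo (0:ℝ) 1) (g : (Fin n → Bool) → ℝ)
    (T : ℝ) (hT : 0 < T) :
    muE n p (fun x => g x ^ 2) * Real.log T - T * (muE n p (fun x => |g x|)) ^ 2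
      ≤ SqF n p g :=
  (ent_lower n p hp g T hT).trans (lsi p hp n g)

lemma SqF_smul (n : ℕ) (p c : ℝ) (f : (Fin n → Bool) → ℝ) :
    SqF n p (fun x => c * f x) = c ^ 2 * SqF n p f := by
  unfold SqF
  rw [Finset.mul_sum]
  refine Finset.sum_congr rfl fun i _ => ?_
  rw [← muE_smul]
  congr 1; funext x; simp only [grad]; ring

lemma SqF_split (n : ℕ) (p : ℝ) (f0 f1 : (Fin n → Bool) → ℝ) :
    (1-p) * SqF n p f0 + p * SqF n p f1 =
      SqF n p (fun x => (1-p) * f0 x + p * f1 x)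
        + p * (1-p) * SqF n p (fun x => f1 x - f0 x) := by
  unfold SqF
  simp only [Finset.mul_sum]
  rw [← Finset.sum_add_distrib, ← Finset.sum_add_distrib]
  refine Finset.sum_congr rfl fun i _ => ?_
  rw [← muE_smul, ← muE_smul, ← muE_smul, ← muE_add, ← muE_add]
  congr 1; funext x; simp only [grad]; ring

lemma talagrand (p : ℝ) (hp : p ∈ Set.Ioo (0:ℝ) 1) (T : ℝ) (hT : 0 < T) (n : ℕ) :
    ∀ f : (Fin n → Bool) → ℝ,
    varE n p f * Real.log T - T * ∑ i, (muE n p (fun x => |grad n i f x|)) ^ 2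
      ≤ SqF n p f := by
  induction n with
  | zero => intro f; simp [varE, SqF, muE_zero]
  | succ n ih =>
    intro f
    obtain ⟨h0, h1⟩ := hp
    have hq : 0 < 1 - p := by linarith
    set f0 : (Fin n → Bool) → ℝ := fun y => f (Fin.cons false y) with hf0
    set f1 : (Fin n → Bool) → ℝ := fun y => f (Fin.cons true y) with hf1
    set h : (Fin n → Bool) → ℝ := fun y => f1 y - f0 y with hh
    set fb : (Fin n → Bool) → ℝ := fun y => (1-p) * f0 y + p * f1 y with hfb
    set d : (Fin (n+1) → Bool) → ℝ := fun x => f x - fb (Fin.tail x) with hd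
    have d0 : (fun y => d (Fin.cons false y)) = fun y => (-p) * h y := by
      funext y; simp only [hd, hfb, hh, hf0, hf1, Fin.tail_cons]; ring
    have d1 : (fun y => d (Fin.cons true y)) = fun y => (1-p) * h y := by
      funext y; simp only [hd, hfb, hh, hf0, hf1, Fin.tail_cons]; ring
    have d0' : ∀ y, d (Fin.cons false y) = (-p) * h y := fun y => congrFun d0 y
    have d1' : ∀ y, d (Fin.cons true y) = (1-p) * h y := fun y => congrFun d1 y
    have L := SqF_lower (n+1) p ⟨h0, h1⟩ d T hT
    have Ed2 : muE (n+1) p (fun x => d x ^ 2) = p * (1-p) * muE n p (fun y => h y ^ 2) := by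
      rw [muE_succ]; simp only [d0', d1', mul_pow, muE_smul]; ring
    have Ed1 : muE (n+1) p (fun x => |d x|) = 2 * (p * (1-p)) * muE n p (fun y => |h y|) := by
      rw [muE_succ]
      simp only [d0', d1', abs_mul, abs_neg, abs_of_pos h0, abs_of_pos hq, muE_smul]; ring
    have Sd : SqF (n+1) p d = muE n p (fun y => h y ^ 2) + p * (1-p) * SqF n p h := by
      rw [SqF_succ, d0, d1, SqF_smul, SqF_smul]
      have : (fun y => (d (Fin.cons true y) - d (Fin.cons false y)) ^ 2)
          = fun y => h y ^ 2 := by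
        funext y; rw [d0', d1']; ring
      rw [this]; ring
    have Sf : SqF (n+1) p f = muE n p (fun y => h y ^ 2)
        + (SqF n p fb + p * (1-p) * SqF n p h) := by
      rw [SqF_succ, ← SqF_split n p f0 f1, add_assoc]
    have V : varE (n+1) p f = varE n p fb + p * (1-p) * muE n p (fun y => h y ^ 2) := by
      have e1 : muE n p (fun y => fb y ^ 2) + p * (1-p) * muE n p (fun y => h y ^ 2)
        = (1-p) * muE n p (fun y => f0 y ^ 2) + p * muE n p (fun y => f1 y ^ 2) := by
        rw [← muE_smul, ← muE_smul, ← muE_smul, ← muE_add, ← muE_add]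
        congr 1; funext x; simp only [hfb, hh]; ring
      have e2 : muE n p fb = (1-p) * muE n p f0 + p * muE n p f1 := by
        rw [hfb, muE_add, muE_smul, muE_smul]
      unfold varE
      rw [muE_succ, muE_succ, e2]
      linarith
    have I := ih fb
    have inf0 : muE (n+1) p (fun x => |grad (n+1) 0 f x|) = muE n p (fun y => |h y|) := by
      rw [muE_succ]; simp only [grad_zero_cons]; simp only [hh, hf0, hf1]; ring
    have infs : ∀ i : Fin n, (muE n p (fun x => |grad n i fb x|)) ^ 2 ≤
        (muE (n+1) p (fun x => |grad (n+1) i.succ f x|)) ^ 2 := by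
      intro i
      refine pow_le_pow_left₀ (muE_nonneg n p ⟨h0, h1⟩ _ fun x => abs_nonneg _) ?_ 2
      rw [muE_succ]; simp only [grad_succ_cons]
      rw [← muE_smul, ← muE_smul, ← muE_add]
      refine muE_mono n p ⟨h0, h1⟩ _ _ fun x => ?_
      have : grad n i fb x = (1-p) * grad n i f0 x + p * grad n i f1 x := by
        simp only [grad, hfb]; ring
      rw [this]
      refine (abs_add_le _ _).trans ?_
      rw [abs_mul, abs_mul, abs_of_pos h0, abs_of_pos hq]
    rw [Fin.sum_univ_succ, inf0]
    have sums := Finset.sum_le_sum fun i (_ : i ∈ (Finset.univ : Finset (Fin n))) => infs i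
    have sums' := mul_le_mul_of_nonneg_left sums hT.le
    have small : T * (2 * (p * (1-p)) * muE n p (fun y => |h y|)) ^ 2
        ≤ T * (muE n p (fun y => |h y|)) ^ 2 := by
      refine mul_le_mul_of_nonneg_left ?_ hT.le
      have hk0 : 0 ≤ muE n p (fun y => |h y|) := muE_nonneg n p ⟨h0, h1⟩ _ fun x => abs_nonneg _
      refine pow_le_pow_left₀ (by positivity) ?_ 2
      have : 2 * (p * (1-p)) ≤ 1 := by nlinarith [sq_nonneg (p - 1/2)]
      nlinarith
    rw [Ed2, Ed1, Sd] at L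
    rw [V, Sf]
    linarith

lemma russo (n : ℕ) : ∀ (f : (Fin n → Bool) → ℝ) (p : ℝ),
    HasDerivAt (fun p => muE n p f) (∑ i, muE n p (grad n i f)) p := by
  induction n with
  | zero => intro f p; simp only [muE_zero]; simpa using hasDerivAt_const p (f default)
  | succ n ih =>
    intro f p
    have i0 := ih (fun y => f (Fin.cons false y)) p
    have i1 := ih (fun y => f (Fin.cons true y)) p
    have := (((hasDerivAt_const p (1:ℝ)).sub (hasDerivAt_id p)).mul i0).add
      ((hasDerivAt_id p).mul i1)
    simp only [muE_succ]
    refine this.congr_deriv ?_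
    rw [Fin.sum_univ_succ]
    simp only [grad_zero_cons, grad_succ_cons, Finset.sum_add_distrib, ← Finset.mul_sum]
    have e : muE n p (fun y => f (Fin.cons true y) - f (Fin.cons false y))
      = muE n p (fun y => f (Fin.cons true y)) - muE n p (fun y => f (Fin.cons false y)) := by
      simp [muE, mul_sub]
    rw [e]
    simp only [id, Pi.sub_apply]
    change _ = _ + ((1-p) * ∑ i, muE n p (grad n i (fun z => f (Fin.cons false z)))
      + p * ∑ i, muE n p (grad n i (fun z => f (Fin.cons true z))))
    ring

open Classical in
/-- Indicator function. -/
noncomputable def indF (n : ℕ) (A : Finset (Fin n → Bool)) (x : Fin n → Bool) : ℝ :=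
  if x ∈ A then 1 else 0

lemma muE_ind (n : ℕ) (p : ℝ) (A : Finset (Fin n → Bool)) : muE n p (indF n A) = muP n p A := by
  simp [muE, muP, indF]

lemma muE_symm (n : ℕ) (p : ℝ) (A : Finset (Fin n → Bool)) (hA : SymmetricSet n A)
    (i j : Fin n) : muE n p (grad n i (indF n A)) = muE n p (grad n j (indF n A)) := by
  obtain ⟨G, ht, hG⟩ := hA
  obtain ⟨g, hg, hgij⟩ := ht i j
  have inv : ∀ x : Fin n → Bool, indF n A (fun k => x (g⁻¹ k)) = indF n A x := by
    intro x
    have : (fun k => x (g⁻¹ k)) ∈ A ↔ x ∈ A := by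
      constructor
      · intro h
        have := hG g⁻¹ (G.inv_mem hg) _ h
        simpa using this
      · exact hG g hg x
    unfold indF; simp only [this]
  unfold muE
  rw [← (Equiv.arrowCongr g (Equiv.refl Bool)).sum_comp
    (fun x => muW n p x * grad n j (indF n A) x)]
  refine Finset.sum_congr rfl fun x _ => ?_
  have e : (Equiv.arrowCongr g (Equiv.refl Bool)) x = fun k => x (g⁻¹ k) := rfl
  rw [e]
  congr 1
  · unfold muW
    exact (Equiv.prod_comp g⁻¹ (fun k => if x k then p else 1 - p)).symm
  · have u : ∀ b, Function.update (fun k => x (g⁻¹ k)) j b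
        = fun k => (Function.update x i b) (g⁻¹ k) := by
      intro b
      funext k
      by_cases hk : k = j
      · subst hk
        have : g⁻¹ k = i := by rw [← hgij]; simp
        simp [this]
      · have : g⁻¹ k ≠ i := by
          intro h; apply hk; rw [← hgij, ← h]; simp
        rw [Function.update_of_ne hk, Function.update_of_ne this]
    unfold grad
    rw [u, u, inv, inv]

lemma grad_ind (n : ℕ) (A : Finset (Fin n → Bool)) (hA : MonotoneSet n A) (i : Fin n)
    (x : Fin n → Bool) : grad n i (indF n A) x = 0 ∨ grad n i (indF n A) x = 1 := by
  have : Function.update x i false ∈ A → Function.update x i true ∈ A := by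
    intro h
    refine hA _ h _ fun k => ?_
    by_cases hk : k = i
    · subst hk; simp
    · simp [Function.update_of_ne hk]
  unfold grad indF
  by_cases h1 : Function.update x i false ∈ A
  · simp [h1, this h1]
  · by_cases h2 : Function.update x i true ∈ A <;> simp [h1, h2]

lemma key (n : ℕ) (hn : 2 ≤ n) (A : Finset (Fin n → Bool)) (hm : MonotoneSet n A)
    (hs : SymmetricSet n A) (p : ℝ) (hp : p ∈ Set.Ioo (0:ℝ) 1) :
    muP n p A * (1 - muP n p A) * Real.log n / 4 ≤ ∑ i, muE n p (grad n i (indF n A)) := by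
  set S := ∑ i, muE n p (grad n i (indF n A)) with hS
  have hn0 : (0:ℝ) < n := by positivity
  have hn1 : (1:ℝ) ≤ n := by exact_mod_cast (by omega : 1 ≤ n)
  have hsq : SqF n p (indF n A) = S := by
    unfold SqF
    refine Finset.sum_congr rfl fun i _ => ?_
    congr 1; funext x
    rcases grad_ind n A hm i x with h | h <;> simp [h]
  have habs : ∀ i, muE n p (fun x => |grad n i (indF n A) x|) = muE n p (grad n i (indF n A)) := by
    intro i
    congr 1; funext x
    rcases grad_ind n A hm i x with h | h <;> simp [h]
  have hv : varE n p (indF n A) = muP n p A * (1 - muP n p A) := by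
    unfold varE
    have : (fun x => indF n A x ^ 2) = indF n A := by
      funext x; simp [indF]
    rw [this, muE_ind]; ring
  have hI : ∀ i, muE n p (grad n i (indF n A)) = S / n := by
    intro i
    have : S = n * muE n p (grad n i (indF n A)) := by
      rw [hS, Finset.sum_congr rfl fun j _ => muE_symm n p A hs j i]
      simp
    rw [this]; field_simp
  have hS0 : 0 ≤ S := by
    rw [← hsq]; exact Finset.sum_nonneg fun i _ => muE_nonneg n p hp _ fun x => sq_nonneg _
  set r := √(√(n:ℝ)) with hr
  have hr2 : r ^ 2 = √(n:ℝ) := Real.sq_sqrt (Real.sqrt_nonneg _)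
  have hr4 : r ^ 4 = n := by
    have : r ^ 4 = (r ^ 2) ^ 2 := by ring
    rw [this, hr2, Real.sq_sqrt hn0.le]
  have hr1 : 1 ≤ r := by
    rw [hr, Real.one_le_sqrt, Real.one_le_sqrt]; exact hn1
  have hr0 : 0 < r := by linarith
  have hlog : Real.log n = 4 * Real.log r := by
    rw [← hr4, Real.log_pow]; norm_num
  have hlr : Real.log r ≤ r := by linarith [Real.log_le_sub_one_of_pos hr0]
  have hlr0 : 0 ≤ Real.log r := Real.log_nonneg hr1
  have t := talagrand p hp (r ^ 2) (by positivity) n (indF n A)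
  rw [hsq, hv, Finset.sum_congr rfl fun i _ => by rw [habs i, hI i], Real.log_pow] at t
  simp only [Finset.sum_const, Finset.card_univ, Fintype.card_fin, nsmul_eq_mul] at t
  have e : r ^ 2 * (n * (S / n) ^ 2) = (S / r) ^ 2 := by
    rw [← hr4]; field_simp
  rw [e] at t
  set v := muP n p A * (1 - muP n p A) with hvd
  have hv1 : v ≤ 1 := by nlinarith [sq_nonneg (muP n p A - 1/2)]
  rw [hlog]
  push_cast at t
  by_cases hc : r ≤ S
  · nlinarith
  · push Not at hc
    have a1 : S / r ≤ 1 := by rw [div_le_one hr0]; exact hc.le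
    have a2 : 0 ≤ S / r := by positivity
    have a3 : S / r ≤ S := div_le_self hS0 hr1
    have : (S / r)^2 ≤ S := by nlinarith
    linarith

lemma muP_mem (n : ℕ) (A : Finset (Fin n → Bool)) (h1 : A.Nonempty) (h2 : A ≠ Finset.univ)
    (p : ℝ) (hp : p ∈ Set.Ioo (0:ℝ) 1) : 0 < muP n p A ∧ muP n p A < 1 := by
  constructor
  · exact Finset.sum_pos (fun x _ => muW_pos n p hp x) h1
  · have tot : ∀ m, muE m p (fun _ => 1) = 1 := by
      intro m
      induction m with
      | zero => simp [muE_zero]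
      | succ m ih => rw [muE_succ, ih]; ring
    have := tot n
    simp only [muE, mul_one] at this
    rw [← this]
    obtain ⟨x, hx⟩ : ∃ x, x ∉ A := by
      by_contra h; push Not at h; exact h2 (Finset.eq_univ_iff_forall.mpr h)
    exact Finset.sum_lt_sum_of_subset (Finset.subset_univ _) (Finset.mem_univ x) hx
      (muW_pos n p hp x) fun y _ _ => (muW_pos n p hp y).le

/-- Corollary 1.6: There is a universal `C' > 0` such that for every `n ≥ 2`,
every nontrivial monotone symmetric `A ⊆ {0,1}^n` and every `ε ∈ (0,1/2)`,
`τ(A,ε) ≤ C' log((1-ε)/ε)/log n`. -/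
theorem stmt3 :
    ∃ C' > (0 : ℝ), ∀ n : ℕ, 2 ≤ n → ∀ A : Finset (Fin n → Bool),
      MonotoneSet n A → SymmetricSet n A → A.Nonempty → A ≠ Finset.univ →
      ∀ ε ∈ Set.Ioo (0 : ℝ) (1 / 2), ∀ pe p1e : ℝ,
        pe ∈ Set.Ioo (0 : ℝ) 1 → muP n pe A = ε →
        p1e ∈ Set.Ioo (0 : ℝ) 1 → muP n p1e A = 1 - ε →
        p1e - pe ≤ C' * (Real.log ((1 - ε) / ε) / Real.log n) := by
  refine ⟨8, by norm_num, ?_⟩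
  intro n hn A hm hs hne hnu ε hε pe p1e hpe he hp1 h1
  obtain ⟨hε0, hε1⟩ := hε
  have hlogn : 0 < Real.log n := Real.log_pos (by exact_mod_cast (by omega : 1 < n))
  have hle : 0 ≤ Real.log ((1 - ε) / ε) := by
    apply Real.log_nonneg
    rw [le_div_iff₀ hε0]; linarith
  by_cases hlt : pe < p1e
  swap
  · push Not at hlt
    have : 0 ≤ 8 * (Real.log ((1 - ε) / ε) / Real.log n) := by positivity
    linarith
  have hder : ∀ p ∈ Set.Ioo (0:ℝ) 1,
      HasDerivAt (fun p => Real.log (muP n p A) - Real.log (1 - muP n p A))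
        ((∑ i, muE n p (grad n i (indF n A))) / muP n p A
          - (-(∑ i, muE n p (grad n i (indF n A)))) / (1 - muP n p A)) p := by
    intro p hp
    obtain ⟨a, b⟩ := muP_mem n A hne hnu p hp
    have r := russo n (indF n A) p
    simp only [muE_ind] at r
    exact (r.log a.ne').sub ((r.const_sub 1).log (by linarith))
  have hsub : ∀ p ∈ Set.Icc pe p1e, p ∈ Set.Ioo (0:ℝ) 1 := fun p hp =>
    ⟨lt_of_lt_of_le hpe.1 hp.1, lt_of_le_of_lt hp.2 hp1.2⟩
  obtain ⟨c, hc, hcs⟩ := exists_hasDerivAt_eq_slope _ _ hlt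
    (fun p hp => (hder p (hsub p hp)).continuousAt.continuousWithinAt)
    (fun p hp => hder p (hsub p ⟨hp.1.le, hp.2.le⟩))
  have hc' := hsub c ⟨hc.1.le, hc.2.le⟩
  obtain ⟨a, b⟩ := muP_mem n A hne hnu c hc'
  have k := key n hn A hm hs c hc'
  have b' : 0 < 1 - muP n c A := by linarith
  set S := ∑ i, muE n c (grad n i (indF n A))
  have e : S / muP n c A - (-S) / (1 - muP n c A) = S / (muP n c A * (1 - muP n c A)) := by
    field_simp; ring
  have low : Real.log n / 4 ≤ S / (muP n c A * (1 - muP n c A)) := by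
    rw [le_div_iff₀ (mul_pos a b')]; linarith
  have hd : 0 < p1e - pe := by linarith
  rw [← e, hcs, le_div_iff₀ hd] at low
  simp only [he, h1] at low
  rw [sub_sub_cancel] at low
  have el : Real.log ((1 - ε) / ε) = Real.log (1 - ε) - Real.log ε :=
    Real.log_div (by linarith) hε0.ne'
  rw [el, ← mul_div_assoc, le_div_iff₀ hlogn]
  linarith
end

section
/- (Russo's lemma) For every positive integer n, every monotone subset A of {0,1}^n, and every p ∈ [0,1], the derivative with respect to p of the polynomial map p ↦ μ_{n,p}(A) equals ∑_{i=1}^n I_A(i), the sum of the influences of the n coordinates on A. -/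
open Finset

/-- The product of the weights of all coordinates other than `i`. -/
noncomputable def restW (n : ℕ) (p : ℝ) (i : Fin n) (x : Fin n → Bool) : ℝ :=
  ∏ j ∈ Finset.univ.erase i, if x j then p else 1 - p

theorem muW_eq_restW (n : ℕ) (p : ℝ) (i : Fin n) (x : Fin n → Bool) :
    muW n p x = restW n p i x * (if x i then p else 1 - p) := by
  unfold muW restW
  rw [Finset.prod_erase_mul _ _ (Finset.mem_univ i)]

theorem restW_update (n : ℕ) (p : ℝ) (i : Fin n) (x : Fin n → Bool) (b : Bool) :
    restW n p i (Function.update x i b) = restW n p i x := by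
  unfold restW
  refine Finset.prod_congr rfl fun j hj => ?_
  rw [Function.update_of_ne (Finset.ne_of_mem_erase hj)]

theorem hasDerivAt_muW (n : ℕ) (p : ℝ) (x : Fin n → Bool) :
    HasDerivAt (fun q => muW n q x)
      (∑ i : Fin n, restW n p i x * (if x i then 1 else -1)) p := by
  have h := HasDerivAt.fun_finsetProd (u := (Finset.univ : Finset (Fin n)))
    (f := fun i q => if x i then q else 1 - q)
    (f' := fun i => if x i then (1 : ℝ) else -1) (x := p) (by
      intro i _
      by_cases hx : x i
      · simpa [hx] using hasDerivAt_id' p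
      · simpa [hx] using (hasDerivAt_id p).const_sub 1)
  simpa only [muW, restW, smul_eq_mul] using h

/-- A function on the cube whose sum along every edge in direction `i` vanishes has total sum 0. -/
theorem sum_eq_zero_of_edge (n : ℕ) (i : Fin n) (g : (Fin n → Bool) → ℝ)
    (hg : ∀ x, g (Function.update x i true) + g (Function.update x i false) = 0) :
    ∑ x, g x = 0 := by
  have hinv : Function.Involutive (fun x : Fin n → Bool => Function.update x i (!x i)) := by
    intro x
    simp
  have h1 : ∑ x, g (Function.update x i (!x i)) = ∑ x, g x :=
    Equiv.sum_comp hinv.toPerm g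
  have h2 : ∑ x, (g x + g (Function.update x i (!x i))) = 0 := by
    refine Finset.sum_eq_zero fun x _ => ?_
    have hx := hg x
    cases hb : x i
    · have : Function.update x i false = x := by rw [← hb, Function.update_eq_self]
      rw [this] at hx
      simpa [add_comm] using hx
    · have : Function.update x i true = x := by rw [← hb, Function.update_eq_self]
      rw [this] at hx
      simpa using hx
  rw [Finset.sum_add_distrib, h1] at h2
  linarith

theorem sum_eq_inflSet (n : ℕ) (A : Finset (Fin n → Bool)) (hmono : MonotoneSet n A)
    (p : ℝ) (i : Fin n) :
    ∑ x ∈ A, restW n p i x * (if x i then 1 else -1) = inflSet n p i A := by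
  classical
  unfold inflSet muP
  rw [Finset.sum_filter, ← sub_eq_zero, ← Finset.filter_univ_mem A, Finset.sum_filter,
    ← Finset.sum_sub_distrib]
  apply sum_eq_zero_of_edge n i
  intro x
  have hm : Function.update x i false ∈ A → Function.update x i true ∈ A := by
    intro h
    refine hmono _ h _ fun j => ?_
    by_cases hj : j = i
    · subst hj; simp
    · simp [hj]
  simp only [muW_eq_restW n p i, restW_update, Function.update_idem, Function.update_self,
    Finset.filter_univ_mem]
  by_cases h0 : Function.update x i false ∈ A
  · simp [h0, hm h0]
  · by_cases h1 : Function.update x i true ∈ A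
    · simp [h0, h1]; ring
    · simp [h0, h1]

/-- Russo's lemma: for monotone `A`, `dμ_p(A)/dp = ∑ᵢ I_A(i)`. -/
theorem stmt6 (n : ℕ) (hn : 0 < n) (A : Finset (Fin n → Bool))
    (hmono : MonotoneSet n A) (p : ℝ) (hp : p ∈ Set.Icc (0 : ℝ) 1) :
    deriv (fun q => muP n q A) p = ∑ i : Fin n, inflSet n p i A := by
  have h : HasDerivAt (fun q => muP n q A)
      (∑ x ∈ A, ∑ i : Fin n, restW n p i x * (if x i then 1 else -1)) p := by
    unfold muP
    exact HasDerivAt.fun_sum fun x _ => hasDerivAt_muW n p x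
  rw [h.deriv, Finset.sum_comm]
  exact Finset.sum_congr rfl fun i _ => sum_eq_inflSet n A hmono p i
end
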